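/- With the resonator coefficients f = f_M as defined, Q₁/Q₂ = exp( √(log M / log log M) (1 + o(1)) ) as M → ∞, where Q₁ = Π_p (1 + f(p)² + f(p)/√p) and Q₂ = Π_p (1 + f(p)²). -/

import Mathlib

open Filter Finset
open scoped Classical

/-- `L = √(log M · log log M)` for the resonator parameter `M`. -/
noncomputable def resL (M : ℕ) : ℝ := Real.sqrt (Real.log M * Real.log (Real.log M))

/-- The value of the resonator coefficients at a prime `p`:
`f(p) = L/(√p log p)` if `L² ≤ p ≤ exp((log L)²)`, and `f(p) = 0` otherwise. -/
noncomputable def resFp (M p : ℕ) : ℝ :=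
  if resL M ^ 2 ≤ (p : ℝ) ∧ (p : ℝ) ≤ Real.exp (Real.log (resL M) ^ 2) then
    resL M / (Real.sqrt p * Real.log p)
  else 0

/-- The resonator coefficients `f = f_M`: the multiplicative function supported on squarefree
integers determined by its values `resFp` at primes. -/
noncomputable def resF (M n : ℕ) : ℝ :=
  if Squarefree n then ∏ p ∈ n.primeFactors, resFp M p else 0

/-- `Q₁ = Π_p (1 + f(p)² + f(p)/√p)`. -/
noncomputable def resQ1 (M : ℕ) : ℝ :=
  ∏ᶠ p ∈ {p : ℕ | p.Prime}, (1 + resFp M p ^ 2 + resFp M p / Real.sqrt p)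

/-- `Q₂ = Π_p (1 + f(p)²)`. -/
noncomputable def resQ2 (M : ℕ) : ℝ :=
  ∏ᶠ p ∈ {p : ℕ | p.Prime}, (1 + resFp M p ^ 2)

/-- The multiplicative function `g` supported on squarefree integers with `g(p) = 1 + f(p)²`. -/
noncomputable def resG (M n : ℕ) : ℝ :=
  if Squarefree n then ∏ p ∈ n.primeFactors, (1 + resFp M p ^ 2) else 0

lemma log_factorial_eq_sum_primes (N : ℕ) :
    Real.log (N.factorial : ℝ) =
      ∑ p ∈ Ioc 0 N with p.Prime, (N.factorial.factorization p : ℝ) * Real.log p := by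
  rw [Real.log_nat_eq_sum_factorization]
  refine Finsupp.sum_of_support_subset _ (fun p hp => ?_) _ (by simp)
  have hp' := Nat.prime_of_mem_primeFactors (by simpa using hp)
  have hdvd := Nat.dvd_of_mem_primeFactors (by simpa using hp)
  simp only [mem_filter, mem_Ioc]
  exact ⟨⟨hp'.pos, (hp'.dvd_factorial).1 hdvd⟩, hp'⟩

lemma div_sub_one_le_factorization_factorial {p N : ℕ} (hp : p.Prime) (hpN : p ≤ N) :
    (N : ℝ) / p - 1 ≤ (N.factorial.factorization p : ℝ) := by
  have h : N / p ≤ N.factorial.factorization p := by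
    rw [Nat.factorization_factorial hp (Nat.lt_succ_self _)]
    have h1 : 1 ∈ Ico 1 (Nat.log p N).succ := by
      have := Nat.log_pos hp.one_lt hpN
      rw [mem_Ico]; omega
    simpa using single_le_sum (f := fun i => N / p ^ i) (fun _ _ => Nat.zero_le _) h1
  have h2 : (N : ℝ) / p < (N / p : ℕ) + 1 := by
    rw [← Nat.floor_div_eq_div (K := ℝ)]
    exact Nat.lt_floor_add_one _
  have h3 : ((N / p : ℕ) : ℝ) ≤ (N.factorial.factorization p : ℝ) := by exact_mod_cast h
  linarith

lemma factorization_factorial_le_div {p N : ℕ} (hp : p.Prime) :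
    (N.factorial.factorization p : ℝ) ≤ (N : ℝ) / (p - 1) := by
  have h := Nat.factorization_factorial_le_div_pred hp N
  calc (N.factorial.factorization p : ℝ) ≤ ((N / (p - 1) : ℕ) : ℝ) := by exact_mod_cast h
    _ ≤ (N : ℝ) / ((p - 1 : ℕ) : ℝ) := Nat.cast_div_le
    _ = _ := by rw [Nat.cast_sub hp.one_le]; simp

lemma exists_sum_log_div_mul_pred_le :
    ∃ C : ℝ, ∀ N : ℕ, ∑ p ∈ Ioc 0 N with p.Prime, Real.log p / (p * (p - 1)) ≤ C := by
  have hs : Summable fun n : ℕ => 4 * (1 / (n : ℝ) ^ (3 / 2 : ℝ)) :=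
    (Real.summable_one_div_nat_rpow.2 (by norm_num)).mul_left 4
  refine ⟨∑' n : ℕ, 4 * (1 / (n : ℝ) ^ (3 / 2 : ℝ)), fun N => ?_⟩
  refine le_trans (sum_le_sum fun p hp => ?_) (hs.sum_le_tsum _ fun n _ => by positivity)
  have hp2 : (2 : ℝ) ≤ p := by exact_mod_cast (mem_filter.1 hp).2.two_le
  have hlog := Real.log_le_rpow_div (x := p) (ε := 1 / 2) (by positivity) (by norm_num)
  have hpow : (p : ℝ) ^ (3 / 2 : ℝ) * (p : ℝ) ^ (1 / 2 : ℝ) = (p : ℝ) ^ 2 := by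
    rw [← Real.rpow_add (by positivity)]; norm_num
  have hpos : 0 < (p : ℝ) ^ (3 / 2 : ℝ) := by positivity
  rw [mul_one_div, div_le_div_iff₀ (by nlinarith) hpos]
  calc Real.log p * (p : ℝ) ^ (3 / 2 : ℝ)
      ≤ ((p : ℝ) ^ (1 / 2 : ℝ) / (1 / 2)) * (p : ℝ) ^ (3 / 2 : ℝ) := by gcongr
    _ = 2 * (p : ℝ) ^ 2 := by rw [← hpow]; ring
    _ ≤ 4 * (p * (p - 1)) := by nlinarith

/-- **Mertens' first theorem**. -/
theorem exists_abs_sum_log_div_sub_log_le :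
    ∃ C : ℝ, ∀ N : ℕ, N ≠ 0 →
      |∑ p ∈ Ioc 0 N with p.Prime, Real.log p / p - Real.log N| ≤ C := by
  obtain ⟨C, hC⟩ := exists_sum_log_div_mul_pred_le
  refine ⟨max (Real.log 4) (1 + C), fun N hN => ?_⟩
  have hN0 : (0 : ℝ) < N := by positivity
  have hlog : ∀ p : ℕ, 0 ≤ Real.log p := fun p => Real.log_natCast_nonneg p
  have hfact_le : Real.log (N.factorial : ℝ) ≤ N * Real.log N := by
    rw [← Real.log_pow]
    exact Real.log_le_log (by positivity) (by exact_mod_cast Nat.factorial_le_pow N)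
  have hfact_ge : N * Real.log N - N ≤ Real.log (N.factorial : ℝ) := by
    have h1 := Stirling.le_log_factorial_stirling hN
    have h2 : 0 ≤ Real.log (2 * Real.pi) := Real.log_nonneg (by linarith [Real.pi_gt_three])
    linarith [hlog N]
  have htheta : ∑ p ∈ Ioc 0 N with p.Prime, Real.log p ≤ Real.log 4 * N := by
    simpa [Chebyshev.theta] using Chebyshev.theta_le_log4_mul_x (x := N) hN0.le
  rw [abs_le]
  constructor
  · have h : Real.log (N.factorial : ℝ) ≤
        N * (∑ p ∈ Ioc 0 N with p.Prime, Real.log p / p) + N * C := by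
      calc Real.log (N.factorial : ℝ)
          ≤ ∑ p ∈ Ioc 0 N with p.Prime,
              (N * (Real.log p / p) + N * (Real.log p / (p * (p - 1)))) := by
            rw [log_factorial_eq_sum_primes]
            refine sum_le_sum fun p hp => ?_
            have hp := (mem_filter.1 hp).2
            have hp2 : (2 : ℝ) ≤ p := by exact_mod_cast hp.two_le
            have hp1 : (p : ℝ) - 1 ≠ 0 := by linarith
            refine (mul_le_mul_of_nonneg_right (factorization_factorial_le_div hp)
              (hlog p)).trans_eq ?_
            field_simp
            ring
        _ ≤ _ := by
            rw [sum_add_distrib, ← mul_sum, ← mul_sum]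
            gcongr
            exact hC N
    have h2 : N * (Real.log N - 1) ≤
        N * (∑ p ∈ Ioc 0 N with p.Prime, Real.log p / p + C) := by linarith
    have := le_of_mul_le_mul_left h2 hN0
    linarith [le_max_right (Real.log 4) (1 + C)]
  · have h : N * (∑ p ∈ Ioc 0 N with p.Prime, Real.log p / p) -
        ∑ p ∈ Ioc 0 N with p.Prime, Real.log p ≤ Real.log (N.factorial : ℝ) := by
      rw [log_factorial_eq_sum_primes, mul_sum, ← sum_sub_distrib]
      refine sum_le_sum fun p hp => ?_
      obtain ⟨hpN, hp⟩ := mem_filter.1 hp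
      refine le_of_eq_of_le ?_ (mul_le_mul_of_nonneg_right
        (div_sub_one_le_factorization_factorial hp (mem_Ioc.1 hpN).2) (hlog p))
      ring
    have h2 : N * (∑ p ∈ Ioc 0 N with p.Prime, Real.log p / p) ≤
        N * (Real.log N + Real.log 4) := by linarith
    have := le_of_mul_le_mul_left h2 hN0
    linarith [le_max_left (Real.log 4) (1 + C)]

lemma inv_mul_log_eq (p : ℕ) : 1 / (p * Real.log p) = Real.log p / p * (1 / Real.log p ^ 2) := by
  rcases eq_or_ne (Real.log p) 0 with h | h
  · simp [h]
  · field_simp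

/-- Partial summation of `1 / (p log p)` against Mertens' first theorem. -/
lemma exists_sum_inv_mul_log_bounds :
    ∃ C : ℝ, ∀ m n : ℕ, 2 ≤ m → m ≤ n →
      ∑ p ∈ Ioc m n with p.Prime, 1 / (p * Real.log p) ≤ 1 / Real.log m + C / Real.log m ^ 2 ∧
      1 / Real.log (m + 1) - 1 / Real.log (n + 1) - C / Real.log m ^ 2 ≤
        ∑ p ∈ Ioc m n with p.Prime, 1 / (p * Real.log p) := by
  obtain ⟨C, hC⟩ := exists_abs_sum_log_div_sub_log_le
  set E : ℕ → ℝ := fun N => ∑ p ∈ Ioc 0 N with p.Prime, Real.log p / p - Real.log N with hE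
  set T : ℕ → ℕ → ℝ := fun m n => ∑ p ∈ Ioc m n with p.Prime, 1 / (p * Real.log p) with hT
  have hEC : ∀ N, N ≠ 0 → -C ≤ E N ∧ E N ≤ C := fun N hN => abs_le.1 (hC N hN)
  have key : ∀ m n : ℕ, 2 ≤ m → m ≤ n →
      T m n ≤ 1 / Real.log m - 1 / Real.log n + (E n - C) / Real.log n ^ 2
        + 2 * C / Real.log m ^ 2 ∧
      1 / Real.log (m + 1) - 1 / Real.log (n + 1) + (E n + C) / Real.log n ^ 2
        - 2 * C / Real.log m ^ 2 ≤ T m n := by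
    intro m n hm hmn
    induction n, hmn using Nat.le_induction with
    | base =>
      have hEm := hEC m (by omega)
      have hT0 : T m m = 0 := by simp [hT]
      have hl : 0 ≤ 1 / Real.log m ^ 2 := by positivity
      rw [hT0]
      rw [div_eq_mul_one_div (E m - C), div_eq_mul_one_div (E m + C), div_eq_mul_one_div (2 * C)]
      constructor <;> nlinarith
    | succ n hmn ih =>
      have hEn := hEC n (by omega)
      have hn : (2 : ℝ) ≤ n := by exact_mod_cast hm.trans hmn
      have ha : 0 < Real.log n := Real.log_pos (by linarith)
      have hab : Real.log n ≤ Real.log (n + 1) := Real.log_le_log (by linarith) (by linarith)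
      have hbc : Real.log (n + 1) ≤ Real.log (n + 1 + 1) :=
        Real.log_le_log (by linarith) (by linarith)
      have hconc : Real.log (n + 1 + 1) - Real.log (n + 1) ≤ Real.log (n + 1) - Real.log n := by
        rw [← Real.log_div (by positivity) (by positivity),
          ← Real.log_div (by positivity) (by positivity)]
        refine Real.log_le_log (by positivity) ?_
        rw [div_le_div_iff₀ (by positivity) (by positivity)]
        nlinarith
      have hstep : T m (n + 1) = T m n +
          (Real.log (n + 1) - Real.log n + E (n + 1) - E n) * (1 / Real.log (n + 1) ^ 2) := by
        simp only [hT, hE]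
        rw [sum_filter, sum_filter, sum_filter, sum_filter, sum_Ioc_succ_top (by omega),
          sum_Ioc_succ_top (by omega)]
        split_ifs
        · rw [inv_mul_log_eq]; push_cast; ring
        · push_cast; ring
      rw [hstep]
      push_cast
      generalize Real.log (n + 1 + 1 : ℝ) = c at *
      generalize Real.log (n + 1 : ℝ) = b at *
      generalize Real.log (n : ℝ) = a at *
      have hb : 0 < b := by linarith
      have hc : 0 < c := by linarith
      have hsq : 1 / b ^ 2 ≤ 1 / a ^ 2 := by gcongr
      have h1 : (b - a) * (1 / b ^ 2) ≤ 1 / a - 1 / b := by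
        have : 1 / a - 1 / b - (b - a) * (1 / b ^ 2) = (b - a) ^ 2 / (a * b ^ 2) := by
          field_simp
        have h0 : 0 ≤ (b - a) ^ 2 / (a * b ^ 2) := by positivity
        linarith
      have h2 : 1 / b - 1 / c ≤ (b - a) * (1 / b ^ 2) := by
        calc 1 / b - 1 / c = (c - b) * (1 / (b * c)) := by field_simp
          _ ≤ (c - b) * (1 / b ^ 2) := by
            refine mul_le_mul_of_nonneg_left ?_ (by linarith)
            rw [sq]; gcongr
          _ ≤ _ := by gcongr
      obtain ⟨ih1, ih2⟩ := ih
      rw [div_eq_mul_one_div (E n - C)] at ih1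
      rw [div_eq_mul_one_div (E n + C)] at ih2
      rw [div_eq_mul_one_div (E (n + 1) - C), div_eq_mul_one_div (E (n + 1) + C)]
      generalize 1 / b ^ 2 = B at *
      generalize 1 / a ^ 2 = A at *
      have h3 := mul_nonneg (sub_nonneg.2 hsq) (sub_nonneg.2 hEn.1)
      have h4 := mul_nonneg (sub_nonneg.2 hsq) (sub_nonneg.2 hEn.2)
      constructor <;> linarith
  refine ⟨2 * C, fun m n hm hmn => ?_⟩
  have hEn := hEC n (by omega)
  have hlog : 0 ≤ 1 / Real.log n := by
    have := Real.log_natCast_nonneg n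
    positivity
  have hl : 0 ≤ 1 / Real.log n ^ 2 := by positivity
  obtain ⟨h1, h2⟩ := key m n hm hmn
  rw [div_eq_mul_one_div _ (Real.log n ^ 2)] at h1 h2
  constructor <;> nlinarith

lemma tendsto_log_div_of_abs_sub_le {g : ℝ → ℝ} {B : ℝ}
    (hg : ∀ᶠ y in atTop, |g y - Real.log y| ≤ B) :
    Tendsto (fun y => Real.log y / g y) atTop (nhds 1) := by
  have h0 : Tendsto (fun y => (g y - Real.log y) / Real.log y) atTop (nhds 0) := by
    refine squeeze_zero_norm' ?_ (Real.tendsto_log_atTop.const_div_atTop B)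
    filter_upwards [hg, Real.tendsto_log_atTop.eventually_gt_atTop 0] with y hy hy0
    rw [norm_div, Real.norm_eq_abs, Real.norm_of_nonneg hy0.le]
    gcongr
  have h1 := ((h0.const_add 1).inv₀ (by norm_num))
  simp only [add_zero, inv_one] at h1
  refine h1.congr' ?_
  filter_upwards [Real.tendsto_log_atTop.eventually_gt_atTop 0] with y hy0
  rw [← inv_div]
  field_simp
  ring

lemma tendsto_log_mul_sum_inv_mul_log :
    Tendsto (fun y : ℝ => Real.log y *
      ∑ p ∈ Ioc (⌈y⌉₊ - 1) ⌊Real.exp ((Real.log y / 2) ^ 2)⌋₊ with p.Prime,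
        1 / (p * Real.log p)) atTop (nhds 1) := by
  obtain ⟨C, hC⟩ := exists_sum_inv_mul_log_bounds
  set m : ℝ → ℕ := fun y => ⌈y⌉₊ - 1 with hm
  set n : ℝ → ℕ := fun y => ⌊Real.exp ((Real.log y / 2) ^ 2)⌋₊ with hn
  have hmy : ∀ y : ℝ, 3 ≤ y → y ≤ (m y : ℝ) + 1 ∧ (m y : ℝ) ≤ y := by
    intro y hy
    have h1 : 1 ≤ ⌈y⌉₊ := Nat.one_le_ceil_iff.2 (by linarith)
    have h2 : (m y : ℝ) + 1 = ⌈y⌉₊ := by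
      simp only [hm]; push_cast [h1]; ring
    have h3 := Nat.le_ceil y
    have h4 := Nat.ceil_lt_add_one (show 0 ≤ y by linarith)
    constructor <;> linarith
  have hlog2 : ∀ y z : ℝ, 0 < y → 0 < z → y ≤ 2 * z → z ≤ 2 * y →
      |Real.log z - Real.log y| ≤ Real.log 2 := by
    intro y z hy hz h1 h2
    have h3 := Real.log_le_log hy h1
    have h4 := Real.log_le_log hz h2
    rw [Real.log_mul (by norm_num) (by positivity)] at h3 h4
    rw [abs_le]
    constructor <;> linarith
  have hlim := Real.tendsto_log_atTop
  have t1 : Tendsto (fun y => Real.log y / Real.log (m y)) atTop (nhds 1) := by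
    refine tendsto_log_div_of_abs_sub_le (B := Real.log 2) ?_
    filter_upwards [eventually_ge_atTop 3] with y hy
    obtain ⟨h1, h2⟩ := hmy y hy
    exact hlog2 _ _ (by linarith) (by linarith) (by linarith) (by linarith)
  have t2 : Tendsto (fun y => Real.log y / Real.log (m y + 1)) atTop (nhds 1) := by
    refine tendsto_log_div_of_abs_sub_le (B := Real.log 2) ?_
    filter_upwards [eventually_ge_atTop 3] with y hy
    obtain ⟨h1, h2⟩ := hmy y hy
    exact hlog2 _ _ (by linarith) (by linarith) (by linarith) (by linarith)
  have hnlog : ∀ y, (Real.log y / 2) ^ 2 ≤ Real.log (n y + 1) := fun y => by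
    rw [Real.le_log_iff_exp_le (by positivity)]
    exact (Nat.lt_floor_add_one _).le
  have t3 : Tendsto (fun y => Real.log y / Real.log (n y + 1)) atTop (nhds 0) := by
    refine squeeze_zero' ?_ ?_ (hlim.const_div_atTop 4)
    · filter_upwards [hlim.eventually_gt_atTop 0] with y hy
      have := (sq_nonneg _).trans (hnlog y)
      positivity
    · filter_upwards [hlim.eventually_gt_atTop 0] with y hy
      have h1 := hnlog y
      have h2 : 0 < Real.log (n y + 1) := lt_of_lt_of_le (by positivity) h1
      rw [div_le_div_iff₀ h2 hy]
      nlinarith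
  have t4 : Tendsto (fun y => C * (Real.log y / Real.log (m y)) ^ 2 / Real.log y)
      atTop (nhds 0) := ((t1.pow 2).const_mul C).div_atTop hlim
  have hmn : ∀ᶠ y in atTop, 2 ≤ m y ∧ m y ≤ n y := by
    filter_upwards [eventually_ge_atTop 3, hlim.eventually_ge_atTop 4] with y hy hly
    obtain ⟨h1, h2⟩ := hmy y hy
    constructor
    · have : (2 : ℝ) ≤ m y := by linarith
      exact_mod_cast this
    · refine Nat.le_floor (h2.trans ?_)
      rw [← Real.log_le_iff_le_exp (by linarith)]
      nlinarith
  refine tendsto_of_tendsto_of_tendsto_of_le_of_le' (g := fun y =>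
      Real.log y / Real.log (m y + 1) - Real.log y / Real.log (n y + 1)
        - C * (Real.log y / Real.log (m y)) ^ 2 / Real.log y)
      (h := fun y => Real.log y / Real.log (m y)
        + C * (Real.log y / Real.log (m y)) ^ 2 / Real.log y) ?_ ?_ ?_ ?_
  · simpa using (t2.sub t3).sub t4
  · simpa using t1.add t4
  · filter_upwards [hmn, hlim.eventually_gt_atTop 0] with y hy hly
    refine le_of_eq_of_le ?_ (mul_le_mul_of_nonneg_left (hC _ _ hy.1 hy.2).2 hly.le)
    field_simp
  · filter_upwards [hmn, hlim.eventually_gt_atTop 0] with y hy hly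
    refine (mul_le_mul_of_nonneg_left (hC _ _ hy.1 hy.2).1 hly.le).trans_eq ?_
    field_simp

/-- The primes at which `resFp M` is nonzero. -/
noncomputable def resPrimes (M : ℕ) : Finset ℕ :=
  {p ∈ Ioc (⌈resL M ^ 2⌉₊ - 1) ⌊Real.exp ((Real.log (resL M ^ 2) / 2) ^ 2)⌋₊ | p.Prime}

lemma mem_resPrimes {M p : ℕ} :
    p ∈ resPrimes M ↔ p.Prime ∧ resL M ^ 2 ≤ p ∧
      (p : ℝ) ≤ Real.exp (Real.log (resL M) ^ 2) := by
  have h : Real.log (resL M ^ 2) / 2 = Real.log (resL M) := by rw [Real.log_pow]; push_cast; ring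
  rw [resPrimes, h, mem_filter, mem_Ioc, and_comm, and_congr_right_iff]
  intro hp
  have := hp.pos
  rw [Nat.le_floor_iff (by positivity), ← Nat.ceil_le]
  refine and_congr_left fun _ => ?_
  omega

lemma resFp_of_mem {M p : ℕ} (h : p ∈ resPrimes M) :
    resFp M p = resL M / (Real.sqrt p * Real.log p) :=
  if_pos (mem_resPrimes.1 h).2

lemma resFp_of_prime_of_notMem {M p : ℕ} (hp : p.Prime) (h : p ∉ resPrimes M) :
    resFp M p = 0 :=
  if_neg fun h' => h (mem_resPrimes.2 ⟨hp, h'⟩)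

lemma finprod_mem_primes_eq_prod_resPrimes {M : ℕ} {g : ℕ → ℝ}
    (hg : ∀ p, resFp M p = 0 → g p = 1) :
    ∏ᶠ p ∈ {p : ℕ | p.Prime}, g p = ∏ p ∈ resPrimes M, g p := by
  refine finprod_mem_eq_prod_of_subset _ (fun p hp => ?_) fun p hp => ?_
  · by_contra h
    exact hp.2 (hg p (resFp_of_prime_of_notMem hp.1 h))
  · exact (mem_resPrimes.1 hp).1

lemma resQ1_div_resQ2 (M : ℕ) :
    resQ1 M / resQ2 M =
      ∏ p ∈ resPrimes M, (1 + (resFp M p / Real.sqrt p) / (1 + resFp M p ^ 2)) := by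
  rw [resQ1, resQ2, finprod_mem_primes_eq_prod_resPrimes (M := M) (by simp +contextual),
    finprod_mem_primes_eq_prod_resPrimes (M := M) (by simp +contextual), ← prod_div_distrib]
  refine prod_congr rfl fun p _ => ?_
  have : 1 + resFp M p ^ 2 ≠ 0 := by positivity
  rw [add_div, div_self this]

lemma resFp_div_sqrt {M p : ℕ} (h : p ∈ resPrimes M) :
    resFp M p / Real.sqrt p = resL M * (1 / (p * Real.log p)) := by
  have hp := (mem_resPrimes.1 h).1.pos
  rw [resFp_of_mem h, div_div, mul_right_comm, Real.mul_self_sqrt (by positivity),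
    mul_one_div]

lemma resFp_sq {M p : ℕ} (h : p ∈ resPrimes M) :
    resFp M p ^ 2 = resL M ^ 2 / (p * Real.log p ^ 2) := by
  rw [resFp_of_mem h, div_pow, mul_pow, Real.sq_sqrt (by positivity)]

lemma log_one_add_bounds {M p : ℕ} (hL : Real.exp 1 ≤ resL M) (h : p ∈ resPrimes M) :
    0 < 1 + (resFp M p / Real.sqrt p) / (1 + resFp M p ^ 2) ∧
    Real.log (1 + (resFp M p / Real.sqrt p) / (1 + resFp M p ^ 2)) ≤
      resL M * (1 / (p * Real.log p)) ∧
    resL M * (1 / (p * Real.log p)) /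
        (1 + (1 / Real.log (resL M ^ 2) ^ 2 + 1 / Real.log (resL M ^ 2))) ≤
      Real.log (1 + (resFp M p / Real.sqrt p) / (1 + resFp M p ^ 2)) := by
  obtain ⟨hp, hp1, -⟩ := mem_resPrimes.1 h
  have hL1 : 1 < resL M := by linarith [Real.add_one_le_exp (1 : ℝ)]
  have hL2 : 1 < resL M ^ 2 := by nlinarith
  have hly : 0 < Real.log (resL M ^ 2) := Real.log_pos hL2
  have hlp : Real.log (resL M ^ 2) ≤ Real.log p := Real.log_le_log (by linarith) hp1
  have hlp0 : 0 < Real.log p := by linarith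
  have hp0 : (0 : ℝ) < p := by linarith
  have hF : resFp M p ^ 2 ≤ 1 / Real.log (resL M ^ 2) ^ 2 := by
    rw [resFp_sq h]
    calc resL M ^ 2 / (p * Real.log p ^ 2) ≤ p / (p * Real.log p ^ 2) := by gcongr
      _ = 1 / Real.log p ^ 2 := by field_simp
      _ ≤ _ := by gcongr
  have hv : resL M * (1 / (p * Real.log p)) ≤ 1 / Real.log (resL M ^ 2) := by
    calc resL M * (1 / (p * Real.log p)) ≤ p * (1 / (p * Real.log p)) := by
          gcongr; nlinarith
      _ = 1 / Real.log p := by field_simp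
      _ ≤ _ := by gcongr
  rw [resFp_div_sqrt h]
  have hv0 : 0 ≤ resL M * (1 / (p * Real.log p)) := by positivity
  have hF0 := sq_nonneg (resFp M p)
  generalize resFp M p ^ 2 = F at *
  generalize resL M * (1 / (p * Real.log p)) = v at *
  generalize 1 / Real.log (resL M ^ 2) ^ 2 = a at *
  generalize 1 / Real.log (resL M ^ 2) = b at *
  have hpos : 0 < 1 + v / (1 + F) := by positivity
  refine ⟨hpos, ?_, ?_⟩
  · have h1 := Real.log_le_sub_one_of_pos hpos
    have h2 : v / (1 + F) ≤ v := div_le_self hv0 (by linarith)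
    linarith
  · have h1 := Real.one_sub_inv_le_log_of_pos hpos
    have h2 : 1 - (1 + v / (1 + F))⁻¹ = v / (1 + (F + v)) := by
      have : 1 + F ≠ 0 := by positivity
      have : 1 + F + v ≠ 0 := by positivity
      have : 1 + (F + v) ≠ 0 := by positivity
      field_simp
      ring
    have h3 : v / (1 + (a + b)) ≤ v / (1 + (F + v)) := by gcongr
    linarith

lemma tendsto_div_log_mul_log :
    Tendsto (fun x : ℝ => Real.log x / Real.log (x * Real.log x)) atTop (nhds 1) := by
  have h0 : Tendsto (fun x : ℝ => Real.log x / x) atTop (nhds 0) :=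
    Real.isLittleO_log_id_atTop.tendsto_div_nhds_zero
  have h1 := ((h0.comp Real.tendsto_log_atTop).const_add 1).inv₀ (by norm_num)
  simp only [add_zero, inv_one] at h1
  refine h1.congr' ?_
  filter_upwards [eventually_gt_atTop 0, Real.tendsto_log_atTop.eventually_gt_atTop 0]
    with x hx hlx
  rw [Real.log_mul hx.ne' hlx.ne', Function.comp_apply, one_add_div hlx.ne', inv_div]

/-- With the resonator coefficients `f = f_M` as defined,
`Q₁/Q₂ = exp(√(log M / log log M) (1 + o(1)))` as `M → ∞`. -/
theorem resonator_quotient_asymptotic :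
    ∃ e : ℕ → ℝ, Tendsto e atTop (nhds 0) ∧
      ∀ᶠ M : ℕ in atTop,
        resQ1 M / resQ2 M =
          Real.exp (Real.sqrt (Real.log M / Real.log (Real.log M)) * (1 + e M)) := by
  have hlog : Tendsto (fun M : ℕ => Real.log M) atTop atTop :=
    Real.tendsto_log_atTop.comp tendsto_natCast_atTop_atTop
  have hloglog : Tendsto (fun M : ℕ => Real.log (Real.log M)) atTop atTop :=
    Real.tendsto_log_atTop.comp hlog
  have hLsq : ∀ᶠ M : ℕ in atTop, resL M ^ 2 = Real.log M * Real.log (Real.log M) := by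
    filter_upwards [hlog.eventually_gt_atTop 0, hloglog.eventually_gt_atTop 0] with M h1 h2
    exact Real.sq_sqrt (by positivity)
  have hy : Tendsto (fun M : ℕ => resL M ^ 2) atTop atTop :=
    (hlog.atTop_mul_atTop₀ hloglog).congr' (hLsq.mono fun _ h => h.symm)
  have hL : Tendsto resL atTop atTop :=
    Real.tendsto_sqrt_atTop.comp (hlog.atTop_mul_atTop₀ hloglog)
  have hly : Tendsto (fun M : ℕ => Real.log (resL M ^ 2)) atTop atTop :=
    Real.tendsto_log_atTop.comp hy
  set S : ℕ → ℝ := fun M => ∑ p ∈ resPrimes M, 1 / (p * Real.log p) with hS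
  have hS1 : Tendsto (fun M => Real.log (resL M ^ 2) * S M) atTop (nhds 1) :=
    tendsto_log_mul_sum_inv_mul_log.comp hy
  have hratio : Tendsto (fun M : ℕ => Real.log (Real.log M) / Real.log (resL M ^ 2))
      atTop (nhds 1) := by
    refine (tendsto_div_log_mul_log.comp hlog).congr' ?_
    filter_upwards [hLsq] with M h
    simp [h]
  have hmain : Tendsto (fun M : ℕ => Real.log (Real.log M) * S M) atTop (nhds 1) := by
    have h := hratio.mul hS1
    rw [one_mul] at h
    refine h.congr' ?_
    filter_upwards [hly.eventually_gt_atTop 0] with M hM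
    field_simp
  set δ : ℕ → ℝ := fun M => 1 / Real.log (resL M ^ 2) ^ 2 + 1 / Real.log (resL M ^ 2) with hδ
  have hδ0 : Tendsto δ atTop (nhds 0) := by
    have h1 := hly.const_div_atTop 1
    have h2 := ((tendsto_pow_atTop two_ne_zero).comp hly).const_div_atTop 1
    rw [← add_zero (0 : ℝ)]
    exact h2.add h1
  set R : ℕ → ℝ := fun M => Real.sqrt (Real.log M / Real.log (Real.log M)) with hR
  have hRL : ∀ᶠ M in atTop, 0 < R M ∧ resL M = R M * Real.log (Real.log M) := by
    filter_upwards [hlog.eventually_gt_atTop 0, hloglog.eventually_gt_atTop 0] with M h1 h2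
    refine ⟨Real.sqrt_pos.2 (by positivity), ?_⟩
    rw [resL, Real.sqrt_eq_iff_mul_self_eq (by positivity) (by positivity),
      mul_mul_mul_comm, Real.mul_self_sqrt (by positivity)]
    field_simp
  have hbd : ∀ᶠ M in atTop, 0 < resQ1 M / resQ2 M ∧
      Real.log (resQ1 M / resQ2 M) ≤ resL M * S M ∧
      resL M * S M / (1 + δ M) ≤ Real.log (resQ1 M / resQ2 M) := by
    filter_upwards [hL.eventually_ge_atTop (Real.exp 1)] with M hM
    have hb := fun p (hp : p ∈ resPrimes M) => log_one_add_bounds hM hp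
    rw [resQ1_div_resQ2, Real.log_prod fun p hp => (hb p hp).1.ne', hS, mul_sum, sum_div]
    exact ⟨prod_pos fun p hp => (hb p hp).1, sum_le_sum fun p hp => (hb p hp).2.1,
      sum_le_sum fun p hp => (hb p hp).2.2⟩
  refine ⟨fun M => Real.log (resQ1 M / resQ2 M) / R M - 1, ?_, ?_⟩
  · have hlow : Tendsto (fun M : ℕ => Real.log (Real.log M) * S M / (1 + δ M)) atTop (nhds 1) := by
      have h := hmain.div (hδ0.const_add 1) (by norm_num)
      rwa [add_zero, div_one] at h
    have h : Tendsto (fun M => Real.log (resQ1 M / resQ2 M) / R M) atTop (nhds 1) := by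
      refine tendsto_of_tendsto_of_tendsto_of_le_of_le' hlow hmain ?_ ?_
      · filter_upwards [hbd, hRL] with M h1 h2
        rw [le_div_iff₀ h2.1]
        refine le_of_eq_of_le ?_ h1.2.2
        rw [h2.2]
        ring
      · filter_upwards [hbd, hRL] with M h1 h2
        rw [div_le_iff₀ h2.1]
        refine h1.2.1.trans_eq ?_
        rw [h2.2]
        ring
    simpa using h.sub_const 1
  · filter_upwards [hbd, hRL] with M h1 h2
    rw [add_sub_cancel, mul_div_cancel₀ _ h2.1.ne', Real.exp_log h1.1]
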